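/- For every γ with 0 < γ < 1 there exists n₀ ∈ ℕ such that for every n ≥ n₀ the following holds: if G is an n-vertex digraph with minimum total degree δ(G) ≥ (8/5 + γ)n, then for every pair of vertex-disjoint edges ab, yz ∈ E(G) and every set U ⊆ V(G) \ {a, b, y, z} of size at most γn/2, there exists a 2-path x₁x₂…x_{ℓ−1}x_ℓ of length ℓ ≤ 20 in G avoiding all vertices of U, with x₁ = a, x₂ = b, x_{ℓ−1} = y and x_ℓ = z. -/

import Mathlib

namespace Paper

/-- `G` is a digraph: a loopless directed graph (edges in both directions allowed). -/
def IsDigraph {n : ℕ} (G : Fin n → Fin n → Prop) : Prop := ∀ v, ¬ G v v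

/-- `G` is an oriented graph: no loops and at most one directed edge per pair. -/
def IsOriented {n : ℕ} (G : Fin n → Fin n → Prop) : Prop := ∀ u v, G u v → ¬ G v u

/-- Out-degree of `v` in `G`. -/
noncomputable def outDeg {n : ℕ} (G : Fin n → Fin n → Prop) (v : Fin n) : ℕ :=
  {w | G v w}.ncard

/-- In-degree of `v` in `G`. -/
noncomputable def inDeg {n : ℕ} (G : Fin n → Fin n → Prop) (v : Fin n) : ℕ :=
  {w | G w v}.ncard

/-- `G` contains the `k`-th power of a Hamilton cycle: a cyclic ordering `f` of all the
vertices such that each vertex sends an edge to the next `k` vertices (indices mod `n`). -/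
def HasPowHamCycle {n : ℕ} (k : ℕ) (G : Fin n → Fin n → Prop) : Prop :=
  ∃ f : Fin n ≃ Fin n, ∀ (i : Fin n) (j : ℕ), 1 ≤ j → j ≤ k →
    G (f i) (f ⟨((i : ℕ) + j) % n, Nat.mod_lt _ (Nat.lt_of_le_of_lt (Nat.zero_le _) i.isLt)⟩)

/-- `P` is a `k`-path in `G` (the `k`-th power of a directed path): a list of distinct
vertices in which every vertex sends an edge to each of the next `k` vertices. -/
def IsKPath {n : ℕ} (k : ℕ) (G : Fin n → Fin n → Prop) (P : List (Fin n)) : Prop :=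
  P.Nodup ∧ ∀ i j : Fin P.length, (i : ℕ) < (j : ℕ) → (j : ℕ) ≤ (i : ℕ) + k →
    G (P.get i) (P.get j)

open scoped Finset

theorem card_filter_fin_cons {α : Type*} [Fintype α] {k : ℕ} (p : (Fin (k + 1) → α) → Prop)
    [DecidablePred p] :
    #{h | p h} = ∑ x, #{h : Fin k → α | p (Fin.cons x h)} := by
  simp only [Finset.card_filter]
  rw [← Fintype.sum_prod_type', ← (Fin.consEquiv fun _ => α).sum_comp]
  rfl

open scoped Classical in
/-- Among many dense subsets of `T`, some `t` of them have a dense intersection. -/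
theorem exists_subset_card_common {ι T : Type*} [Fintype T] [Nonempty T]
    (I : Finset ι) (A : ι → Finset T) {t : ℕ} {ε : ℝ} (ht : 0 < t)
    (hε : 0 < ε) (hA : ∀ i ∈ I, ε * Fintype.card T ≤ #(A i)) (hI : 2 * t ≤ ε * #I) :
    ∃ J ⊆ I, #J = t ∧
      ε / (4 * 2 ^ #I) * Fintype.card T ≤ #{y | ∀ i ∈ J, y ∈ A i} := by
  by_contra! hcon
  have hpt : ∀ y : T, #{i ∈ I | y ∈ A i} ≤
      t + #I * ∑ J ∈ I.powersetCard t, if ∀ i ∈ J, y ∈ A i then 1 else 0 := by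
    intro y
    by_cases hy : #{i ∈ I | y ∈ A i} ≤ t
    · omega
    · obtain ⟨J, hJ, hJc⟩ := Finset.exists_subset_card_eq (not_le.mp hy).le
      have hmem : J ∈ I.powersetCard t :=
        Finset.mem_powersetCard.mpr ⟨hJ.trans (Finset.filter_subset _ _), hJc⟩
      have h1 : 1 ≤ ∑ J ∈ I.powersetCard t, if ∀ i ∈ J, y ∈ A i then 1 else 0 := by
        refine le_trans ?_ (Finset.single_le_sum
          (f := fun J : Finset ι => if ∀ i ∈ J, y ∈ A i then 1 else 0)
          (fun _ _ => Nat.zero_le _) hmem)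
        rw [if_pos fun i hi => (Finset.mem_filter.mp (hJ hi)).2]
      have h2 : #{i ∈ I | y ∈ A i} ≤ #I := Finset.card_filter_le _ _
      nlinarith
  have hsum : ∑ i ∈ I, #(A i) ≤
      Fintype.card T * t + #I * ∑ J ∈ I.powersetCard t, #{y | ∀ i ∈ J, y ∈ A i} := by
    calc ∑ i ∈ I, #(A i) = ∑ y : T, #{i ∈ I | y ∈ A i} := by
          simp only [Finset.card_filter]
          rw [Finset.sum_comm]
          simp
      _ ≤ ∑ y : T, (t + #I * ∑ J ∈ I.powersetCard t, if ∀ i ∈ J, y ∈ A i then 1 else 0) :=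
          Finset.sum_le_sum fun y _ => hpt y
      _ = _ := by
          simp only [Finset.card_filter]
          rw [Finset.sum_add_distrib, ← Finset.mul_sum, Finset.sum_comm]
          simp
  have hT : (0 : ℝ) < Fintype.card T := by exact_mod_cast Fintype.card_pos
  have hlow : #I * (ε * Fintype.card T) ≤ ∑ i ∈ I, (#(A i) : ℝ) := by
    simpa using Finset.card_nsmul_le_sum I _ _ hA
  have hup : ∑ J ∈ I.powersetCard t, (#{y | ∀ i ∈ J, y ∈ A i} : ℝ) ≤
      ε / 4 * Fintype.card T := by
    have h1 : ∑ J ∈ I.powersetCard t, (#{y | ∀ i ∈ J, y ∈ A i} : ℝ) ≤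
        #(I.powersetCard t) * (ε / (4 * 2 ^ #I) * Fintype.card T) := by
      rw [← nsmul_eq_mul]
      refine Finset.sum_le_card_nsmul _ _ _ fun J hJ => ?_
      obtain ⟨hJ1, hJ2⟩ := Finset.mem_powersetCard.mp hJ
      exact (hcon J hJ1 hJ2).le
    have h2 : (#(I.powersetCard t) : ℝ) ≤ 2 ^ #I := by
      rw [Finset.card_powersetCard]
      exact_mod_cast Nat.choose_le_two_pow _ _
    calc _ ≤ _ := h1
      _ ≤ 2 ^ #I * (ε / (4 * 2 ^ #I) * Fintype.card T) := by gcongr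
      _ = _ := by field_simp
  have hsum' : ∑ i ∈ I, (#(A i) : ℝ) ≤
      Fintype.card T * t + #I * ∑ J ∈ I.powersetCard t, (#{y | ∀ i ∈ J, y ∈ A i} : ℝ) := by
    exact_mod_cast hsum
  have hIpos : (0 : ℝ) < #I := by
    have : (0 : ℝ) < t := by exact_mod_cast ht
    by_contra! h
    nlinarith
  have h3 : (#I : ℝ) * ∑ J ∈ I.powersetCard t, (#{y | ∀ i ∈ J, y ∈ A i} : ℝ) ≤
      #I * (ε / 4 * Fintype.card T) := by gcongr
  have h4 : 2 * t * (Fintype.card T : ℝ) ≤ ε * #I * Fintype.card T := by gcongr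
  have h5 : 0 < ε * #I * Fintype.card T := by positivity
  nlinarith

/-- A dense `k`-partite `k`-uniform hypergraph contains a complete one with parts of size `t`. -/
theorem exists_complete_blowup (t : ℕ) (ht : 0 < t) (k : ℕ) (ε : ℝ) (hε : 0 < ε) :
    ∃ n₀ : ℕ, ∀ n, n₀ ≤ n → ∀ (H : (Fin k → Fin n) → Prop) [DecidablePred H],
      ε * (n : ℝ) ^ k ≤ #{h | H h} →
      ∃ X : Fin k → Finset (Fin n), (∀ i, #(X i) = t) ∧ ∀ h, (∀ i, h i ∈ X i) → H h := by
  classical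
  induction k generalizing ε with
  | zero =>
    refine ⟨0, fun n _ H _ hH => ⟨fun _ => ∅, fun i => i.elim0, fun h _ => ?_⟩⟩
    have hpos : 0 < #{h | H h} := by
      have : (0 : ℝ) < #{h | H h} := lt_of_lt_of_le (by simpa using hε) hH
      exact_mod_cast this
    obtain ⟨g, hg⟩ := Finset.card_pos.mp hpos
    rw [Subsingleton.elim h g]
    exact (Finset.mem_filter.mp hg).2
  | succ k ih =>
    set M := ⌈2 * t / (ε / 2)⌉₊ with hM
    obtain ⟨n₁, hn₁⟩ := ih (ε / 2 / (4 * 2 ^ M)) (by positivity)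
    refine ⟨max (max n₁ ⌈M / (ε / 2)⌉₊) 1, fun n hn H _ hH => ?_⟩
    have hn1 : n₁ ≤ n := le_trans (le_trans (le_max_left _ _) (le_max_left _ _)) hn
    have hnM : M / (ε / 2) ≤ (n : ℝ) :=
      Nat.ceil_le.mp (le_trans (le_trans (le_max_right _ _) (le_max_left _ _)) hn)
    have hn0 : 1 ≤ n := le_trans (le_max_right _ _) hn
    have hnpos : (0 : ℝ) < n := by exact_mod_cast hn0
    have : Nonempty (Fin n) := ⟨⟨0, hn0⟩⟩
    let A : Fin n → Finset (Fin k → Fin n) := fun x => {h | H (Fin.cons x h)}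
    let I : Finset (Fin n) := {x | ε / 2 * (n : ℝ) ^ k ≤ #(A x)}
    have hcardle : ∀ x, (#(A x) : ℝ) ≤ (n : ℝ) ^ k := fun x => by
      have := Finset.card_le_univ (A x)
      simp only [Fintype.card_pi, Fintype.card_fin, Finset.prod_const, Finset.card_univ] at this
      exact_mod_cast this
    have hI : (M : ℝ) ≤ #I := by
      have h1 : (#{h | H h} : ℝ) = ∑ x, (#(A x) : ℝ) := by
        rw [card_filter_fin_cons]; push_cast; rfl
      have h2 : ∑ x, (#(A x) : ℝ) ≤
          ∑ x, ((if x ∈ I then (n : ℝ) ^ k else 0) + ε / 2 * (n : ℝ) ^ k) := by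
        refine Finset.sum_le_sum fun x _ => ?_
        split_ifs with hx
        · exact (hcardle x).trans (le_add_of_nonneg_right (by positivity))
        · have : ¬ (ε / 2 * (n : ℝ) ^ k ≤ #(A x)) := fun h => hx (by simp [I, h])
          linarith
      rw [Finset.sum_add_distrib, Finset.sum_ite_mem] at h2
      simp only [Finset.univ_inter, Finset.sum_const, nsmul_eq_mul, Finset.card_univ,
        Fintype.card_fin] at h2
      have h3 : ε * (n : ℝ) ^ (k + 1) ≤ #I * (n : ℝ) ^ k + n * (ε / 2 * (n : ℝ) ^ k) := by
        linarith
      have h4 : (0 : ℝ) < (n : ℝ) ^ k := by positivity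
      have h5 : ε / 2 * n ≤ #I := by
        refine le_of_mul_le_mul_right ?_ h4
        rw [pow_succ] at h3
        linarith
      rw [div_le_iff₀ (by positivity)] at hnM
      linarith
    obtain ⟨I', hI', hI'M⟩ := Finset.exists_subset_card_eq (Nat.cast_le.mp hI)
    obtain ⟨J, -, hJt, hJc⟩ := exists_subset_card_common I' A ht (half_pos hε)
      (fun i hi => by simpa using (Finset.mem_filter.mp (hI' hi)).2) (by
        rw [hI'M]
        have := Nat.le_ceil (2 * t / (ε / 2))
        rw [div_le_iff₀ (by positivity)] at this
        rw [hM]; linarith)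
    obtain ⟨X, hXt, hX⟩ := hn₁ n hn1 (fun h => ∀ i ∈ J, h ∈ A i) (by
      rw [hI'M] at hJc
      convert hJc using 2
      · simp
      · congr!)
    refine ⟨Fin.cons J X, Fin.cases (by simpa using hJt) (by simpa using hXt), fun h hh => ?_⟩
    have h1 := hX (Fin.tail h) (fun i => by simpa [Fin.tail] using hh i.succ) (h 0)
      (by simpa using hh 0)
    have h2 := (Finset.mem_filter.mp h1).2
    rwa [Fin.cons_self_tail] at h2

/-- Every entry of the list is related to each of the next two entries. -/
def IsSquareWalk {α : Type*} (R : α → α → Prop) : List α → Prop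
  | [] => True
  | x :: l => (∀ y ∈ l.take 2, R x y) ∧ IsSquareWalk R l

theorem IsSquareWalk.cons_cons_cons {α : Type*} {R : α → α → Prop} {x y z : α} {l : List α}
    (hxy : R x y) (hxz : R x z) (h : IsSquareWalk R (y :: z :: l)) :
    IsSquareWalk R (x :: y :: z :: l) :=
  ⟨by simp [hxy, hxz], h⟩

theorem isSquareWalk_map {α β : Type*} {R : β → β → Prop} (f : α → β) (l : List α) :
    IsSquareWalk R (l.map f) ↔ IsSquareWalk (fun i j => R (f i) (f j)) l := by
  induction l with
  | nil => simp [IsSquareWalk]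
  | cons x l ih => simp [IsSquareWalk, ih, ← List.map_take]

theorem isSquareWalk_forall {α ι : Type*} {R : ι → α → α → Prop} {p : ι → Prop} {l : List α}
    (h : ∀ i, p i → IsSquareWalk (R i) l) :
    IsSquareWalk (fun x y => ∀ i, p i → R i x y) l := by
  induction l with
  | nil => trivial
  | cons x l ih => exact ⟨fun y hy i hi => (h i hi).1 y hy, ih fun i hi => (h i hi).2⟩

theorem IsSquareWalk.of_forall₂ {α β : Type*} {R : α → α → Prop} {T : β → β → Prop}
    {m : α → β → Prop} (hm : ∀ i j, R i j → ∀ p q, m i p → m j q → T p q)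
    {l : List α} {L : List β} (hl : List.Forall₂ m l L) (h : IsSquareWalk R l) :
    IsSquareWalk T L := by
  induction hl with
  | nil => trivial
  | @cons x p l L hxp hlL ih =>
    refine ⟨fun q hq => ?_, ih h.2⟩
    have h1 := h.1
    rcases hlL with _ | ⟨h2, _ | ⟨h3, h4⟩⟩ <;> simp at hq h1 <;> grind

theorem IsSquareWalk.rel_get {α : Type*} {R : α → α → Prop} {l : List α}
    (h : IsSquareWalk R l) (i j : Fin l.length) (hij : (i : ℕ) < j) (hji : (j : ℕ) ≤ i + 2) :
    R (l.get i) (l.get j) := by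
  induction l with
  | nil => exact i.elim0
  | cons x l ih =>
    obtain ⟨i, hi⟩ := i
    obtain ⟨j, hj⟩ := j
    obtain _ | j := j
    · simp at hij
    obtain _ | i := i
    · refine h.1 _ ?_
      simp only [List.length_cons] at hj
      rw [List.mem_take_iff_getElem]
      exact ⟨j, by simp at hji ⊢; omega, rfl⟩
    · exact ih h.2 ⟨i, by simpa using hi⟩ ⟨j, by simpa using hj⟩ (by simpa using hij)
        (by simp at hji ⊢; omega)

open scoped Classical in
theorem exists_nodup_forall₂_mem {α β : Type*} (C : α → Finset β) {t : ℕ} (σ : List α)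
    (hC : ∀ i ∈ σ, #(C i) = t) (A : Finset β) (hA : #A + σ.length ≤ t) :
    ∃ Q : List β, List.Forall₂ (fun i q => q ∈ C i) σ Q ∧ Q.Nodup ∧ ∀ q ∈ Q, q ∉ A := by
  induction σ generalizing A with
  | nil => exact ⟨[], by simp⟩
  | cons i σ ih =>
    have hi : #A < #(C i) := by
      rw [hC i (by simp)]
      simp only [List.length_cons] at hA
      omega
    obtain ⟨q, hq, hqA⟩ := Finset.exists_mem_notMem_of_card_lt_card hi
    obtain ⟨Q, hQ, hnd, hav⟩ := ih (fun j hj => hC j (by simp [hj])) (insert q A) (by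
      rw [Finset.card_insert_of_notMem hqA]
      simp only [List.length_cons] at hA
      omega)
    refine ⟨q :: Q, .cons hq hQ, List.nodup_cons.mpr ⟨fun h => hav q h (by simp), hnd⟩, ?_⟩
    intro r hr
    rcases List.mem_cons.mp hr with rfl | hr
    · exact hqA
    · exact fun h => hav r hr (by simp [h])

/-- If all tuples of a complete `k`-partite family with large parts carry square walks of the
same pattern, then these walks can be realised without repeated vertices. -/
theorem exists_nodup_isSquareWalk {n k t : ℕ} {G : Fin n → Fin n → Prop} (hG : IsDigraph G)
    {a b y z : Fin n} (X : Fin k → Finset (Fin n)) (hX : ∀ i, #(X i) = t)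
    (σ : List (Fin k)) (hσ : 4 + σ.length ≤ t)
    (h : ∀ f : Fin k → Fin n, (∀ i, f i ∈ X i) →
      IsSquareWalk G (a :: b :: (σ.map f ++ [y, z]))) :
    ∃ Q : List (Fin n), IsSquareWalk G (a :: b :: (Q ++ [y, z])) ∧ Q.length = σ.length ∧
      Q.Nodup ∧ a ∉ Q ∧ b ∉ Q ∧ y ∉ Q ∧ z ∉ Q ∧ ∀ q ∈ Q, ∃ i, q ∈ X i := by
  classical
  obtain ⟨Q, hQ, hnd, hav⟩ := exists_nodup_forall₂_mem X σ (fun i _ => hX i) {a, b, y, z}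
    (le_trans (by gcongr; exact Finset.card_le_four) hσ)
  have hne : ∀ i, (X i).Nonempty := fun i => Finset.card_pos.mp (by rw [hX]; omega)
  choose g hg using hne
  let ev : (Fin k → Fin n) → Fin k ⊕ Fin n → Fin n := fun f => Sum.elim f id
  let L : List (Fin k ⊕ Fin n) :=
    .inr a :: .inr b :: (σ.map .inl ++ [.inr y, .inr z])
  let m : Fin k ⊕ Fin n → Fin n → Prop := Sum.elim (fun i q => q ∈ X i) (fun v q => q = v)
  have hL : IsSquareWalk (fun i j => ∀ f : Fin k → Fin n, (∀ i, f i ∈ X i) →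
      G (ev f i) (ev f j)) L := by
    refine isSquareWalk_forall fun f hf => (isSquareWalk_map (ev f) L).mp ?_
    simpa [L, ev, Function.comp_def] using h f hf
  refine ⟨Q, IsSquareWalk.of_forall₂ (m := m) ?_ ?_ hL, hQ.length_eq.symm, hnd,
    fun h => hav _ h (by simp), fun h => hav _ h (by simp), fun h => hav _ h (by simp),
    fun h => hav _ h (by simp), ?_⟩
  · intro i j hij p q hp hq
    have hmem : ∀ (f : Fin k → Fin n) (i : Fin k) (p : Fin n), (∀ j, f j ∈ X j) → p ∈ X i →
        ∀ j, Function.update f i p j ∈ X j := by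
      intro f i p hf hp j
      by_cases hji : j = i
      · subst hji; simpa using hp
      · simpa [hji] using hf j
    rcases i with i | i <;> rcases j with j | j <;>
      simp only [m, Sum.elim_inl, Sum.elim_inr] at hp hq
    · by_cases hijn : i = j
      · subst hijn
        exact absurd (hij g hg) (hG _)
      · have := hij _ (hmem _ j q (hmem g i p hg hp) hq)
        simpa [ev, hijn] using this
    · subst hq
      simpa [ev] using hij _ (hmem g i p hg hp)
    · subst hp
      simpa [ev] using hij _ (hmem g j q hg hq)
    · subst hp hq
      simpa [ev] using hij g hg
  · refine .cons rfl (.cons rfl (List.rel_append ?_ (.cons rfl (.cons rfl .nil))))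
    exact List.forall₂_map_left_iff.mpr hQ
  · intro q hq
    obtain ⟨hlen, hget⟩ := List.forall₂_iff_get.mp hQ
    obtain ⟨j, hj, rfl⟩ := List.mem_iff_getElem.mp hq
    exact ⟨_, hget j (by omega) hj⟩

/-- At least `γ * n` vertices outside `U` satisfy `P`. -/
def Many {n : ℕ} (γ : ℝ) (U : Set (Fin n)) (P : Fin n → Prop) : Prop :=
  γ * n ≤ ({x | x ∉ U ∧ P x}.ncard : ℝ)

theorem Many.mono {n : ℕ} {γ : ℝ} {U : Set (Fin n)} {P P' : Fin n → Prop}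
    (h : Many γ U P) (hP : ∀ x, P x → P' x) : Many γ U P' :=
  le_trans h (Nat.cast_le.mpr
    (Set.ncard_le_ncard (fun x hx => And.imp_right (hP x) hx) (Set.toFinite _)))

theorem many_of_sum {n : ℕ} {γ : ℝ} {U : Set (Fin n)} (hU : (U.ncard : ℝ) ≤ γ * n / 2)
    (f : Fin n → ℕ) (K j : ℕ) (hj : 0 < j) (hf : ∀ x, f x ≤ K + j)
    (hsum : K * n + 3 / 2 * j * (γ * n) ≤ ((∑ x, f x : ℕ) : ℝ)) :
    Many γ U (fun x => K < f x) := by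
  classical
  have h1 : ∑ x, f x ≤ ∑ x : Fin n, (K + j * ((if x ∈ U then 1 else 0) +
      if x ∉ U ∧ K < f x then 1 else 0)) := by
    refine Finset.sum_le_sum fun x _ => ?_
    have := hf x
    by_cases hx : x ∈ U
    · simp [hx]; omega
    · by_cases hK : K < f x
      · simp [hx, hK]; omega
      · simp [hx, hK]; omega
  rw [Finset.sum_add_distrib, ← Finset.mul_sum, Finset.sum_add_distrib, ← Finset.card_filter,
    ← Finset.card_filter] at h1
  have h2 : U.ncard = #{x | x ∈ U} := by
    rw [← Set.ncard_coe_finset]; simp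
  have h3 : {x | x ∉ U ∧ K < f x}.ncard = #{x | x ∉ U ∧ K < f x} := by
    rw [← Set.ncard_coe_finset]; simp
  rw [← h2, ← h3] at h1
  have h4 : ((∑ x, f x : ℕ) : ℝ) ≤
      n * K + j * (U.ncard + {x | x ∉ U ∧ K < f x}.ncard) := by
    have h5 : (∑ x, f x) ≤ n * K + j * (U.ncard + {x | x ∉ U ∧ K < f x}.ncard) := by
      simpa using h1
    exact_mod_cast h5
  have hj' : (0 : ℝ) < j := by exact_mod_cast hj
  unfold Many
  refine le_of_mul_le_mul_left ?_ hj'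
  nlinarith

/-- `p` and `q` are joined by edges in both directions. -/
def Dbl {n : ℕ} (G : Fin n → Fin n → Prop) (p q : Fin n) : Prop := G p q ∧ G q p

theorem Dbl.symm {n : ℕ} {G : Fin n → Fin n → Prop} {p q : Fin n} (h : Dbl G p q) :
    Dbl G q p := ⟨h.2, h.1⟩

open scoped Classical in
/-- Indicator of the edge `vx`. -/
noncomputable def edgeInd {n : ℕ} (G : Fin n → Fin n → Prop) (v x : Fin n) : ℕ :=
  if G v x then 1 else 0

theorem edgeInd_le {n : ℕ} (G : Fin n → Fin n → Prop) (v x : Fin n) : edgeInd G v x ≤ 1 := by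
  unfold edgeInd; split_ifs <;> simp

theorem of_edgeInd_pos {n : ℕ} {G : Fin n → Fin n → Prop} {v x : Fin n}
    (h : 0 < edgeInd G v x) : G v x := by
  by_contra hG
  simp [edgeInd, hG] at h

theorem sum_edgeInd_out {n : ℕ} (G : Fin n → Fin n → Prop) (v : Fin n) :
    ∑ x, edgeInd G v x = outDeg G v := by
  classical
  unfold edgeInd outDeg
  rw [← Finset.card_filter, ← Set.ncard_coe_finset]
  simp

theorem sum_edgeInd_in {n : ℕ} (G : Fin n → Fin n → Prop) (v : Fin n) :
    ∑ x, edgeInd G x v = inDeg G v := by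
  classical
  unfold edgeInd inDeg
  rw [← Finset.card_filter, ← Set.ncard_coe_finset]
  simp

/-- The number of edges between `v` and `x`. -/
noncomputable def multi {n : ℕ} (G : Fin n → Fin n → Prop) (v x : Fin n) : ℕ :=
  edgeInd G v x + edgeInd G x v

theorem multi_le {n : ℕ} (G : Fin n → Fin n → Prop) (v x : Fin n) : multi G v x ≤ 2 :=
  add_le_add (edgeInd_le ..) (edgeInd_le ..)

theorem dbl_of_multi {n : ℕ} {G : Fin n → Fin n → Prop} {v x : Fin n} (h : 2 ≤ multi G v x) :
    Dbl G v x := by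
  have h1 := edgeInd_le G v x
  have h2 := edgeInd_le G x v
  unfold multi at h
  exact ⟨of_edgeInd_pos (by omega), of_edgeInd_pos (by omega)⟩

theorem edge_of_multi {n : ℕ} {G : Fin n → Fin n → Prop} {v x : Fin n} (h : 1 ≤ multi G v x) :
    G v x ∨ G x v := by
  unfold multi at h
  by_cases h1 : 0 < edgeInd G v x
  · exact .inl (of_edgeInd_pos h1)
  · exact .inr (of_edgeInd_pos (by omega))

theorem sum_multi {n : ℕ} (G : Fin n → Fin n → Prop) (v : Fin n) :
    ∑ x, multi G v x = outDeg G v + inDeg G v := by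
  simp only [multi, Finset.sum_add_distrib, sum_edgeInd_out, sum_edgeInd_in]

/-- The degree condition together with the size condition on the forbidden set. -/
structure Dense {n : ℕ} (γ : ℝ) (G : Fin n → Fin n → Prop) (U : Set (Fin n)) : Prop where
  pos : 0 < γ
  deg : ∀ v, (8 / 5 + γ) * n ≤ ((outDeg G v + inDeg G v : ℕ) : ℝ)
  card : (U.ncard : ℝ) ≤ γ * n / 2

namespace Dense

variable {n : ℕ} {γ : ℝ} {G : Fin n → Fin n → Prop} {U : Set (Fin n)}

theorem le_sum_multi (h : Dense γ G U) (v : Fin n) :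
    (8 / 5 + γ) * n ≤ ((∑ x, multi G v x : ℕ) : ℝ) := by
  rw [sum_multi]; exact h.deg v

theorem le_sum_out (h : Dense γ G U) (v : Fin n) :
    (3 / 5 + γ) * n ≤ ((∑ x, edgeInd G v x : ℕ) : ℝ) := by
  have h1 := h.deg v
  have h2 : inDeg G v ≤ n := by
    rw [← sum_edgeInd_in]
    simpa using Finset.sum_le_card_nsmul Finset.univ _ 1 fun x _ => edgeInd_le G x v
  have h3 : (inDeg G v : ℝ) ≤ n := by exact_mod_cast h2
  rw [sum_edgeInd_out]
  push_cast at h1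
  linarith

theorem le_sum_in (h : Dense γ G U) (v : Fin n) :
    (3 / 5 + γ) * n ≤ ((∑ x, edgeInd G x v : ℕ) : ℝ) := by
  have h1 := h.deg v
  have h2 : outDeg G v ≤ n := by
    rw [← sum_edgeInd_out]
    simpa using Finset.sum_le_card_nsmul Finset.univ _ 1 fun x _ => edgeInd_le G v x
  have h3 : (outDeg G v : ℝ) ≤ n := by exact_mod_cast h2
  rw [sum_edgeInd_in]
  push_cast at h1
  linarith

theorem nonneg (h : Dense γ G U) : 0 ≤ γ * n := by
  have := h.pos
  positivity

theorem many_out_out (h : Dense γ G U) (p q : Fin n) :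
    Many γ U fun x => G p x ∧ G q x := by
  have := h.nonneg
  refine (many_of_sum h.card (fun x => edgeInd G p x + edgeInd G q x) 1 1 one_pos
    (fun x => ?_) ?_).mono fun x hx => ?_
  · have := edgeInd_le G p x; have := edgeInd_le G q x; omega
  · rw [Finset.sum_add_distrib]
    have := h.le_sum_out p; have := h.le_sum_out q
    push_cast at *
    linarith
  · have := edgeInd_le G p x; have := edgeInd_le G q x
    exact ⟨of_edgeInd_pos (by omega), of_edgeInd_pos (by omega)⟩

theorem many_in_in (h : Dense γ G U) (p q : Fin n) :
    Many γ U fun x => G x p ∧ G x q := by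
  have := h.nonneg
  refine (many_of_sum h.card (fun x => edgeInd G x p + edgeInd G x q) 1 1 one_pos
    (fun x => ?_) ?_).mono fun x hx => ?_
  · have := edgeInd_le G x p; have := edgeInd_le G x q; omega
  · rw [Finset.sum_add_distrib]
    have := h.le_sum_in p; have := h.le_sum_in q
    push_cast at *
    linarith
  · have := edgeInd_le G x p; have := edgeInd_le G x q
    exact ⟨of_edgeInd_pos (by omega), of_edgeInd_pos (by omega)⟩

theorem many_out_dbl (h : Dense γ G U) (p q : Fin n) :
    Many γ U fun x => G p x ∧ Dbl G q x := by
  have := h.nonneg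
  refine (many_of_sum h.card (fun x => edgeInd G p x + multi G q x) 2 1 one_pos
    (fun x => ?_) ?_).mono fun x hx => ?_
  · have := edgeInd_le G p x; have := multi_le G q x; omega
  · rw [Finset.sum_add_distrib]
    have := h.le_sum_out p; have := h.le_sum_multi q
    push_cast at *
    linarith
  · have := edgeInd_le G p x; have := multi_le G q x
    exact ⟨of_edgeInd_pos (by omega), dbl_of_multi (by omega)⟩

theorem many_in_dbl (h : Dense γ G U) (p q : Fin n) :
    Many γ U fun x => G x p ∧ Dbl G q x := by
  have := h.nonneg
  refine (many_of_sum h.card (fun x => edgeInd G x p + multi G q x) 2 1 one_pos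
    (fun x => ?_) ?_).mono fun x hx => ?_
  · have := edgeInd_le G x p; have := multi_le G q x; omega
  · rw [Finset.sum_add_distrib]
    have := h.le_sum_in p; have := h.le_sum_multi q
    push_cast at *
    linarith
  · have := edgeInd_le G x p; have := multi_le G q x
    exact ⟨of_edgeInd_pos (by omega), dbl_of_multi (by omega)⟩

theorem many_dbl_dbl (h : Dense γ G U) (p q : Fin n) :
    Many γ U fun x => Dbl G p x ∧ Dbl G q x := by
  have := h.nonneg
  refine (many_of_sum h.card (fun x => multi G p x + multi G q x) 3 1 one_pos
    (fun x => ?_) ?_).mono fun x hx => ?_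
  · have := multi_le G p x; have := multi_le G q x; omega
  · rw [Finset.sum_add_distrib]
    have := h.le_sum_multi p; have := h.le_sum_multi q
    push_cast at *
    linarith
  · have := multi_le G p x; have := multi_le G q x
    exact ⟨dbl_of_multi (by omega), dbl_of_multi (by omega)⟩

/-- Many vertices are doubly joined to at least three of four given vertices. -/
theorem many_three_of_four (h : Dense γ G U) (p q r s : Fin n) :
    Many γ U fun x => (Dbl G q x ∧ Dbl G r x ∧ Dbl G s x) ∨ (Dbl G p x ∧ Dbl G r x ∧ Dbl G s x) ∨
      (Dbl G p x ∧ Dbl G q x ∧ Dbl G s x) ∨ (Dbl G p x ∧ Dbl G q x ∧ Dbl G r x) := by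
  have := h.nonneg
  refine (many_of_sum h.card
    (fun x => multi G p x + multi G q x + multi G r x + multi G s x) 6 2 two_pos
    (fun x => ?_) ?_).mono fun x hx => ?_
  · have := multi_le G p x; have := multi_le G q x
    have := multi_le G r x; have := multi_le G s x; omega
  · simp only [Finset.sum_add_distrib]
    have := h.le_sum_multi p; have := h.le_sum_multi q
    have := h.le_sum_multi r; have := h.le_sum_multi s
    push_cast at *
    linarith
  · have := multi_le G p x; have := multi_le G q x
    have := multi_le G r x; have := multi_le G s x
    have hd := fun v => @dbl_of_multi n G v x
    by_cases hp : multi G p x < 2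
    · exact .inl ⟨hd q (by omega), hd r (by omega), hd s (by omega)⟩
    by_cases hq : multi G q x < 2
    · exact .inr (.inl ⟨hd p (by omega), hd r (by omega), hd s (by omega)⟩)
    by_cases hr : multi G r x < 2
    · exact .inr (.inr (.inl ⟨hd p (by omega), hd q (by omega), hd s (by omega)⟩))
    · exact .inr (.inr (.inr ⟨hd p (by omega), hd q (by omega), hd r (by omega)⟩))

/-- Many vertices are joined to five given vertices by at least nine of the ten possible edges. -/
theorem many_four_of_five (h : Dense γ G U) (p q u r s : Fin n) :
    Many γ U fun x => (Dbl G q x ∧ Dbl G u x ∧ Dbl G r x ∧ Dbl G s x) ∨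
      (Dbl G p x ∧ Dbl G u x ∧ Dbl G r x ∧ Dbl G s x) ∨
      ((G u x ∨ G x u) ∧ Dbl G p x ∧ Dbl G q x ∧ Dbl G r x ∧ Dbl G s x) ∨
      (Dbl G p x ∧ Dbl G q x ∧ Dbl G u x ∧ Dbl G s x) ∨
      (Dbl G p x ∧ Dbl G q x ∧ Dbl G u x ∧ Dbl G r x) := by
  have := h.nonneg
  refine (many_of_sum h.card
    (fun x => multi G p x + multi G q x + multi G u x + multi G r x + multi G s x) 8 2 two_pos
    (fun x => ?_) ?_).mono fun x hx => ?_
  · have := multi_le G p x; have := multi_le G q x; have := multi_le G u x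
    have := multi_le G r x; have := multi_le G s x; omega
  · simp only [Finset.sum_add_distrib]
    have := h.le_sum_multi p; have := h.le_sum_multi q; have := h.le_sum_multi u
    have := h.le_sum_multi r; have := h.le_sum_multi s
    push_cast at *
    linarith
  · have := multi_le G p x; have := multi_le G q x; have := multi_le G u x
    have := multi_le G r x; have := multi_le G s x
    have hd := fun v => @dbl_of_multi n G v x
    by_cases hp : multi G p x < 2
    · exact .inl ⟨hd q (by omega), hd u (by omega), hd r (by omega), hd s (by omega)⟩
    by_cases hq : multi G q x < 2
    · exact .inr (.inl ⟨hd p (by omega), hd u (by omega), hd r (by omega), hd s (by omega)⟩)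
    by_cases hu : multi G u x < 2
    · exact .inr (.inr (.inl ⟨edge_of_multi (by omega), hd p (by omega), hd q (by omega),
        hd r (by omega), hd s (by omega)⟩))
    by_cases hr : multi G r x < 2
    · exact .inr (.inr (.inr (.inl
        ⟨hd p (by omega), hd q (by omega), hd u (by omega), hd s (by omega)⟩)))
    · exact .inr (.inr (.inr (.inr
        ⟨hd p (by omega), hd q (by omega), hd u (by omega), hd r (by omega)⟩)))

end Dense

section Walks

variable {n : ℕ} (G : Fin n → Fin n → Prop) (a b y z : Fin n)

/-- There is a square walk from `ab` to `yz` with at most `16` inner vertices, all in `S`. -/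
def HasWalk (S : Set (Fin n)) : Prop :=
  ∃ Q : List (Fin n), (∀ q ∈ Q, q ∈ S) ∧ Q.length ≤ 16 ∧
    IsSquareWalk G (a :: b :: (Q ++ [y, z]))

/-- Every square walk from `pq` to `yz` inside a superset of `S` extends to one from `ab` to `yz`
with at most `k` more inner vertices. -/
def Fwd (S : Set (Fin n)) (k : ℕ) (p q : Fin n) : Prop :=
  ∀ S', S ⊆ S' → ∀ Q : List (Fin n), (∀ v ∈ Q, v ∈ S') →
    IsSquareWalk G (p :: q :: (Q ++ [y, z])) →
    ∃ Q' : List (Fin n), (∀ v ∈ Q', v ∈ S') ∧ Q'.length ≤ Q.length + k ∧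
      IsSquareWalk G (a :: b :: (Q' ++ [y, z]))

/-- There is a square walk from `pq` to `yz` with at most `k` inner vertices, all in `S`. -/
def Bwd (S : Set (Fin n)) (k : ℕ) (p q : Fin n) : Prop :=
  ∃ Q : List (Fin n), (∀ v ∈ Q, v ∈ S) ∧ Q.length ≤ k ∧
    IsSquareWalk G (p :: q :: (Q ++ [y, z]))

/-- A pair that is reachable from `ab` in one of its two orders. -/
def FwdPair (S : Set (Fin n)) (k : ℕ) (p q : Fin n) : Prop :=
  Fwd G a b y z S (k + 2) p q ∨ Fwd G a b y z S (k + 2) q p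

/-- A pair from which `yz` is reachable in one of its two orders. -/
def BwdPair (S : Set (Fin n)) (k : ℕ) (p q : Fin n) : Prop :=
  Bwd G y z S k p q ∨ Bwd G y z S k q p

/-- Robust version of `HasWalk`: `j` further vertices can be added to `S`, each in many ways,
such that a walk exists in the end. -/
def Win (γ : ℝ) (U : Set (Fin n)) : ℕ → Set (Fin n) → Prop
  | 0, S => HasWalk G a b y z S
  | j + 1, S => Many γ U fun x => Win γ U j (insert x S)

variable {G a b y z} {γ : ℝ} {U S S' : Set (Fin n)} {k l : ℕ} {p q r s u : Fin n}

theorem Fwd.mono (h : Fwd G a b y z S k p q) (hS : S ⊆ S') (hk : k ≤ l) :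
    Fwd G a b y z S' l p q := fun T hT Q hQ hw => by
  obtain ⟨Q', h1, h2, h3⟩ := h T (hS.trans hT) Q hQ hw
  exact ⟨Q', h1, by omega, h3⟩

theorem Bwd.mono (h : Bwd G y z S k p q) (hS : S ⊆ S') (hk : k ≤ l) :
    Bwd G y z S' l p q := by
  obtain ⟨Q, h1, h2, h3⟩ := h
  exact ⟨Q, fun v hv => hS (h1 v hv), by omega, h3⟩

theorem fwd_self : Fwd G a b y z S 0 a b := fun _ _ Q hQ hw => ⟨Q, hQ, le_rfl, hw⟩

theorem Fwd.step (h : Fwd G a b y z S k p q) (hpq : G p q) (hpr : G p r) (hr : r ∈ S) :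
    Fwd G a b y z S (k + 1) q r := fun T hT Q hQ hw => by
  obtain ⟨Q', h1, h2, h3⟩ := h T hT (r :: Q) (by simpa using ⟨hT hr, hQ⟩)
    (hw.cons_cons_cons hpq hpr)
  exact ⟨Q', h1, by simp at h2; omega, h3⟩

theorem Bwd.step (h : Bwd G y z S k p q) (hrp : G r p) (hrq : G r q) (hq : q ∈ S) :
    Bwd G y z S (k + 1) r p := by
  obtain ⟨Q, h1, h2, h3⟩ := h
  exact ⟨q :: Q, by simpa using ⟨hq, h1⟩, by simpa using h2, h3.cons_cons_cons hrp hrq⟩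

theorem Fwd.hasWalk (h : Fwd G a b y z S k p q) (h' : Bwd G y z S l p q) (hkl : k + l ≤ 16) :
    HasWalk G a b y z S := by
  obtain ⟨Q, h1, h2, h3⟩ := h'
  obtain ⟨Q', h4, h5, h6⟩ := h S subset_rfl Q h1 h3
  exact ⟨Q', h4, by omega, h6⟩

theorem FwdPair.symm (h : FwdPair G a b y z S k p q) : FwdPair G a b y z S k q p := Or.symm h

theorem BwdPair.symm (h : BwdPair G y z S k p q) : BwdPair G y z S k q p := Or.symm h

theorem FwdPair.mono (h : FwdPair G a b y z S k p q) (hS : S ⊆ S') :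
    FwdPair G a b y z S' k p q :=
  Or.imp (fun h => h.mono hS le_rfl) (fun h => h.mono hS le_rfl) h

theorem BwdPair.mono (h : BwdPair G y z S k p q) (hS : S ⊆ S') : BwdPair G y z S' k p q :=
  Or.imp (fun h => h.mono hS le_rfl) (fun h => h.mono hS le_rfl) h

theorem FwdPair.step (h : FwdPair G a b y z S k p q) (hpq : Dbl G p q) (hpr : Dbl G p r)
    (hqr : Dbl G q r) (hp : p ∈ S) (hr : r ∈ S) :
    FwdPair G a b y z S (k + 2) p r := by
  rcases h with h | h
  · exact .inr ((h.step hpq.1 hpr.1 hr).step hqr.1 hpq.2 hp)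
  · exact .inl ((h.step hpq.2 hqr.1 hr).mono subset_rfl (by omega))

theorem BwdPair.step (h : BwdPair G y z S k p q) (hpq : Dbl G p q) (hpr : Dbl G p r)
    (hqr : Dbl G q r) (hp : p ∈ S) (hq : q ∈ S) :
    BwdPair G y z S (k + 2) p r := by
  rcases h with h | h
  · exact .inr ((h.step hpr.2 hqr.2 hq).mono subset_rfl (by omega))
  · exact .inl ((h.step hqr.2 hpr.2 hp).step hpr.1 hpq.1 hq)

theorem hasWalk_of_bowtie {t : Fin n} (hf : Fwd G a b y z S k p q) (hb : Bwd G y z S l r s)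
    (hkl : k + l ≤ 10) (hp : p ∈ S) (hu : u ∈ S) (hr : r ∈ S) (hs : s ∈ S) (ht : t ∈ S)
    (hpq : Dbl G p q) (hpu : Dbl G p u) (hqu : Dbl G q u)
    (hur : Dbl G u r) (hus : Dbl G u s) (hrs : Dbl G r s)
    (h : (Dbl G q t ∧ Dbl G u t ∧ Dbl G r t ∧ Dbl G s t) ∨
      (Dbl G p t ∧ Dbl G u t ∧ Dbl G r t ∧ Dbl G s t) ∨
      ((G u t ∨ G t u) ∧ Dbl G p t ∧ Dbl G q t ∧ Dbl G r t ∧ Dbl G s t) ∨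
      (Dbl G p t ∧ Dbl G q t ∧ Dbl G u t ∧ Dbl G s t) ∨
      (Dbl G p t ∧ Dbl G q t ∧ Dbl G u t ∧ Dbl G r t)) :
    HasWalk G a b y z S := by
  have hqut := hf.step hpq.1 hpu.1 hu
  rcases h with ⟨hqt, hut, hrt, hst⟩ | ⟨hpt, hut, hrt, hst⟩ | ⟨hut, hpt, hqt, hrt, hst⟩ |
    ⟨hpt, hqt, hut, hst⟩ | ⟨hpt, hqt, hut, hrt⟩
  · exact ((((hqut.step hqu.1 hqt.1 ht).step hut.1 hur.1 hr).step hrt.2 hst.2 hs)).hasWalk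
      hb (by omega)
  · exact ((((((hqut.step hqu.1 hpq.2 hp).step hpu.2 hut.1 ht).step hpt.1 hpu.1 hu).step
      hut.2 hrt.2 hr).step hur.1 hus.1 hs)).hasWalk hb (by omega)
  · rcases hut with hut | hut
    · exact ((((hqut.step hqu.1 hqt.1 ht).step hut hur.1 hr).step hrt.2 hst.2 hs)).hasWalk
        hb (by omega)
    · exact (((((hf.step hpq.1 hpt.1 ht).step hqt.1 hqu.1 hu).step hut hrt.2 hr).step
        hur.1 hus.1 hs)).hasWalk hb (by omega)
  · exact ((((((hqut.step hqu.1 hqt.1 ht).step hut.1 hus.1 hs).step hst.2 hut.2 hu).step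
      hus.2 hrs.2 hr).step hur.1 hus.1 hs)).hasWalk hb (by omega)
  · exact (((((hf.step hpq.1 hpt.1 ht).step hqt.1 hqu.1 hu).step hut.2 hrt.2 hr).step
      hur.1 hus.1 hs)).hasWalk hb (by omega)

theorem win_one_of_fwd_bwd (hD : Dense γ G U) (hf : Fwd G a b y z S k p q)
    (hb : Bwd G y z S l r s) (hkl : k + l ≤ 10) (hp : p ∈ S) (hu : u ∈ S) (hr : r ∈ S)
    (hs : s ∈ S) (hpq : Dbl G p q) (hpu : Dbl G p u) (hqu : Dbl G q u)
    (hur : Dbl G u r) (hus : Dbl G u s) (hrs : Dbl G r s) :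
    Win G a b y z γ U 1 S :=
  (hD.many_four_of_five p q u r s).mono fun t ht =>
    hasWalk_of_bowtie (hf.mono (Set.subset_insert t S) le_rfl)
      (hb.mono (Set.subset_insert t S) le_rfl) hkl (.inr hp) (.inr hu) (.inr hr) (.inr hs)
      (.inl rfl) hpq hpu hqu hur hus hrs ht

/-- Two doubly joined triangles that share a vertex `u` can be connected robustly. -/
theorem win_one_of_bowtie (hD : Dense γ G U) (hf : FwdPair G a b y z S k p q)
    (hb : BwdPair G y z S l r s) (hkl : k + l ≤ 8) (hp : p ∈ S) (hq : q ∈ S) (hu : u ∈ S)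
    (hr : r ∈ S) (hs : s ∈ S) (hpq : Dbl G p q) (hpu : Dbl G p u) (hqu : Dbl G q u)
    (hru : Dbl G r u) (hsu : Dbl G s u) (hrs : Dbl G r s) :
    Win G a b y z γ U 1 S := by
  rcases hf with hf | hf <;> rcases hb with hb | hb
  · exact win_one_of_fwd_bwd hD hf hb (by omega) hp hu hr hs hpq hpu hqu hru.symm hsu.symm hrs
  · exact win_one_of_fwd_bwd hD hf hb (by omega) hp hu hs hr hpq hpu hqu hsu.symm hru.symm
      hrs.symm
  · exact win_one_of_fwd_bwd hD hf hb (by omega) hq hu hr hs hpq.symm hqu hpu hru.symm hsu.symm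
      hrs
  · exact win_one_of_fwd_bwd hD hf hb (by omega) hq hu hs hr hpq.symm hqu hpu hsu.symm hru.symm
      hrs.symm

theorem HasWalk.mono (h : HasWalk G a b y z S) (hS : S ⊆ S') : HasWalk G a b y z S' := by
  obtain ⟨Q, h1, h2⟩ := h
  exact ⟨Q, fun q hq => hS (h1 q hq), h2⟩

theorem Win.mono {j : ℕ} (h : Win G a b y z γ U j S) (hS : S ⊆ S') :
    Win G a b y z γ U j S' := by
  induction j generalizing S S' with
  | zero => exact HasWalk.mono h hS
  | succ j ih => exact Many.mono h fun x hx => ih hx (Set.insert_subset_insert hS)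

theorem Win.succ {j : ℕ} (h : Win G a b y z γ U j S) (hM : Many γ U fun _ => True) :
    Win G a b y z γ U (j + 1) S :=
  hM.mono fun x _ => h.mono (Set.subset_insert x S)

/-- Connecting a doubly joined pair `cd` to a doubly joined triangle `wxv` when some vertex is
doubly joined to `c`, `d` and `w`. The pair predicates `A` and `B` stand for the two ends. -/
theorem win_three_of_pair_of_triangle (hD : Dense γ G U)
    {A B : Set (Fin n) → ℕ → Fin n → Fin n → Prop}
    (hAsymm : ∀ {S k p q}, A S k p q → A S k q p)
    (hAmono : ∀ {S S' k p q}, A S k p q → S ⊆ S' → A S' k p q)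
    (hAstep : ∀ {S k p q r}, A S k p q → Dbl G p q → Dbl G p r → Dbl G q r →
      p ∈ S → q ∈ S → r ∈ S → A S (k + 2) p r)
    (hBsymm : ∀ {S k p q}, B S k p q → B S k q p)
    (hBmono : ∀ {S S' k p q}, B S k p q → S ⊆ S' → B S' k p q)
    (hBstep : ∀ {S k p q r}, B S k p q → Dbl G p q → Dbl G p r → Dbl G q r →
      p ∈ S → q ∈ S → r ∈ S → B S (k + 2) p r)
    (hbow : ∀ {S k l p q u r s}, A S k p q → B S l r s → k + l ≤ 8 → p ∈ S → q ∈ S → u ∈ S →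
      r ∈ S → s ∈ S → Dbl G p q → Dbl G p u → Dbl G q u → Dbl G r u → Dbl G s u → Dbl G r s →
      Win G a b y z γ U 1 S)
    {c d w x v u : Fin n} (hA : A S 0 c d) (hB : B S 0 w x)
    (hc : c ∈ S) (hd : d ∈ S) (hw : w ∈ S) (hx : x ∈ S) (hv : v ∈ S) (hu : u ∈ S)
    (hcd : Dbl G c d) (hwx : Dbl G w x) (hwv : Dbl G w v) (hxv : Dbl G x v)
    (hcu : Dbl G c u) (hdu : Dbl G d u) (hwu : Dbl G w u) :
    Win G a b y z γ U 3 S := by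
  have hM : Many γ U fun _ => True := (hD.many_dbl_dbl c d).mono fun _ _ => trivial
  refine (hD.many_four_of_five c d u w x).mono fun t ht => ?_
  have hsub : S ⊆ insert t S := Set.subset_insert t S
  have htT : t ∈ insert t S := .inl rfl
  replace hA := hAmono hA hsub
  replace hB := hBmono hB hsub
  replace hc := hsub hc
  replace hd := hsub hd
  replace hw := hsub hw
  replace hx := hsub hx
  replace hv := hsub hv
  replace hu := hsub hu
  have hAcu := hAstep hA hcd hcu hdu hc hd hu
  have hAdu := hAstep (hAsymm hA) hcd.symm hdu hcu hd hc hu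
  have hBwv := hBstep hB hwx hwv hxv hw hx hv
  have hBxv := hBstep (hBsymm hB) hwx.symm hxv hwv hx hw hv
  rcases ht with ⟨hdt, hut, hwt, hxt⟩ | ⟨hct, hut, hwt, hxt⟩ | ⟨-, hct, hdt, hwt, hxt⟩ |
    ⟨hct, hdt, hut, hxt⟩ | ⟨hct, hdt, hut, hwt⟩
  · exact (hbow hAdu hB (by omega) hd hu htT hw hx hdu hdt hut hwt hxt hwx).succ hM
  · exact (hbow hAcu hB (by omega) hc hu htT hw hx hcu hct hut hwt hxt hwx).succ hM
  · exact (hbow hA hB (by omega) hc hd htT hw hx hcd hct hdt hwt hxt hwx).succ hM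
  · refine (hD.many_four_of_five c u t w x).mono fun e he => ?_
    have hAct := hAstep hA hcd hct hdt hc hd htT
    have hAut := hAstep (hAsymm hAcu) hcu.symm hut hct hu hc htT
    generalize insert t S = T at *
    have hsub : T ⊆ insert e T := Set.subset_insert e T
    have heT : e ∈ insert e T := .inl rfl
    replace hAcu := hAmono hAcu hsub
    replace hAct := hAmono hAct hsub
    replace hAut := hAmono hAut hsub
    replace hB := hBmono hB hsub
    replace hBwv := hBmono hBwv hsub
    replace hBxv := hBmono hBxv hsub
    replace hc := hsub hc
    replace hw := hsub hw
    replace hx := hsub hx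
    replace hv := hsub hv
    replace hu := hsub hu
    replace htT := hsub htT
    rcases he with ⟨hue, hte, hwe, hxe⟩ | ⟨hce, hte, hwe, hxe⟩ | ⟨-, hce, hue, hwe, hxe⟩ |
      ⟨hce, hue, hte, hxe⟩ | ⟨hce, hue, hte, hwe⟩
    · exact hbow hAut hB (by omega) hu htT heT hw hx hut hue hte hwe hxe hwx
    · exact hbow hAct hB (by omega) hc htT heT hw hx hct hce hte hwe hxe hwx
    · exact hbow hAcu hB (by omega) hc hu heT hw hx hcu hce hue hwe hxe hwx
    · exact hbow (hAstep (hAsymm hAct) hct.symm hte hce htT hc heT) hBwv (by omega)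
        htT heT hx hw hv hte hxt.symm hxe.symm hwx hxv.symm hwv
    · exact hbow (hAstep (hAsymm hAcu) hcu.symm hue hce hu hc heT) hBxv (by omega)
        hu heT hw hx hv hue hwu.symm hwe.symm hwx.symm hwv.symm hxv
  · exact (hbow (hAstep (hAsymm hAcu) hcu.symm hut hct hu hc htT) hBxv (by omega)
      hu htT hw hx hv hut hwu.symm hwt.symm hwx.symm hwv.symm hxv).succ hM

theorem win_four {c d e w x v : Fin n} (hD : Dense γ G U) (hA : FwdPair G a b y z S 0 c d)
    (hB : BwdPair G y z S 0 w x)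
    (hc : c ∈ S) (hd : d ∈ S) (he : e ∈ S) (hw : w ∈ S) (hx : x ∈ S) (hv : v ∈ S)
    (hcd : Dbl G c d) (hce : Dbl G c e) (hde : Dbl G d e)
    (hwx : Dbl G w x) (hwv : Dbl G w v) (hxv : Dbl G x v) :
    Win G a b y z γ U 4 S := by
  refine (hD.many_three_of_four c d w x).mono fun u hu => ?_
  have hsub : S ⊆ insert u S := Set.subset_insert u S
  have huT : u ∈ insert u S := .inl rfl
  replace hA := hA.mono hsub
  replace hB := hB.mono hsub
  replace hc := hsub hc
  replace hd := hsub hd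
  replace he := hsub he
  replace hw := hsub hw
  replace hx := hsub hx
  replace hv := hsub hv
  have hleft {c d w x v : Fin n} := win_three_of_pair_of_triangle (S := insert u S)
    (A := FwdPair G a b y z) (B := BwdPair G y z)
    (c := c) (d := d) (w := w) (x := x) (v := v) (u := u) hD .symm .mono
    (fun h h1 h2 h3 hp _ hr => h.step h1 h2 h3 hp hr) .symm .mono
    (fun h h1 h2 h3 hp hq _ => h.step h1 h2 h3 hp hq) (win_one_of_bowtie hD)
  have hright {c d w x v : Fin n} := win_three_of_pair_of_triangle (S := insert u S)
    (A := BwdPair G y z) (B := FwdPair G a b y z)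
    (c := c) (d := d) (w := w) (x := x) (v := v) (u := u) hD .symm .mono
    (fun h h1 h2 h3 hp hq _ => h.step h1 h2 h3 hp hq) .symm .mono
    (fun h h1 h2 h3 hp _ hr => h.step h1 h2 h3 hp hr)
    (fun hA hB hkl hp hq hu hr hs hpq hpu hqu hru hsu hrs =>
      win_one_of_bowtie hD hB hA (by omega) hr hs hu hp hq hrs hru hsu hpu hqu hpq)
  rcases hu with ⟨hdu, hwu, hxu⟩ | ⟨hcu, hwu, hxu⟩ | ⟨hcu, hdu, hxu⟩ | ⟨hcu, hdu, hwu⟩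
  · exact hright hB hA.symm hw hx hd hc he huT hwx hcd.symm hde hce hwu hxu hdu
  · exact hright hB hA hw hx hc hd he huT hwx hcd hce hde hwu hxu hcu
  · exact hleft hA hB.symm hc hd hx hw hv huT hcd hwx.symm hxv hwv hcu hdu hxu
  · exact hleft hA hB hc hd hw hx hv huT hcd hwx hwv hxv hcu hdu hwu

theorem win_ten (hD : Dense γ G U) (hab : G a b) (hyz : G y z) :
    Win G a b y z γ U 10 ∅ := by
  refine (hD.many_out_out a b).mono fun c ⟨hac, hbc⟩ => ?_
  refine (hD.many_out_dbl b c).mono fun d ⟨hbd, hcd⟩ => ?_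
  refine (hD.many_dbl_dbl c d).mono fun e ⟨hce, hde⟩ => ?_
  refine (hD.many_in_in y z).mono fun x ⟨hxy, hxz⟩ => ?_
  refine (hD.many_in_dbl y x).mono fun w ⟨hwy, hxw⟩ => ?_
  refine (hD.many_dbl_dbl w x).mono fun v ⟨hwv, hxv⟩ => ?_
  refine win_four (c := c) (d := d) (e := e) (w := w) (x := x) (v := v) hD (.inl ?_) (.inl ?_)
    (by simp) (by simp) (by simp) (by simp) (by simp) (by simp) hcd hce hde hxw.symm hwv hxv
  · exact (fwd_self.step hab hac (by simp)).step hbc hbd (by simp)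
  · exact ⟨[], by simp, le_rfl, by simp [IsSquareWalk, hxw.2, hwy, hxy, hxz, hyz]⟩

open scoped Classical in
theorem Win.le_card {j : ℕ} (hγ : 0 ≤ γ) (h : Win G a b y z γ U j S) :
    (γ * n) ^ j ≤ #{f : Fin j → Fin n |
      (∀ i, f i ∉ U) ∧ HasWalk G a b y z (S ∪ Set.range f)} := by
  induction j generalizing S with
  | zero =>
    have : HasWalk G a b y z S := h
    simp [this]
  | succ j ih =>
    rw [card_filter_fin_cons]
    have hM : γ * n ≤ (#{x | x ∉ U ∧ Win G a b y z γ U j (insert x S)} : ℝ) := by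
      have h1 : γ * n ≤ ({x | x ∉ U ∧ Win G a b y z γ U j (insert x S)}.ncard : ℝ) := h
      rw [← Set.ncard_coe_finset]
      simpa using h1
    push_cast
    calc (γ * n) ^ (j + 1) = γ * n * (γ * n) ^ j := by ring
      _ ≤ #{x | x ∉ U ∧ Win G a b y z γ U j (insert x S)} * (γ * n) ^ j := by gcongr
      _ ≤ ∑ x ∈ {x | x ∉ U ∧ Win G a b y z γ U j (insert x S)}, (#{f : Fin j → Fin n |
            (∀ i, (Fin.cons x f : Fin (j + 1) → Fin n) i ∉ U) ∧ HasWalk G a b y z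
              (S ∪ Set.range (Fin.cons x f : Fin (j + 1) → Fin n))} : ℝ) := by
          rw [← nsmul_eq_mul]
          refine Finset.card_nsmul_le_sum _ _ _ fun x hx => ?_
          obtain ⟨hxU, hxW⟩ := (Finset.mem_filter.mp hx).2
          refine (ih hxW).trans (Nat.cast_le.mpr (Finset.card_le_card ?_))
          intro f hf
          obtain ⟨hfU, hfW⟩ := (Finset.mem_filter.mp hf).2
          refine Finset.mem_filter.mpr ⟨Finset.mem_univ _, Fin.cases hxU hfU, ?_⟩
          rwa [Fin.range_cons, Set.union_insert, ← Set.insert_union]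
      _ ≤ _ := Finset.sum_le_univ_sum_of_nonneg fun x => Nat.cast_nonneg _

end Walks

/-- Connecting lemma avoiding a small set: for every `0 < γ < 1` there is `n₀` such that in
every digraph on `n ≥ n₀` vertices with minimum total degree at least `(8/5 + γ)n`, for any
two vertex-disjoint edges `ab`, `yz` and any set `U` of at most `γn/2` vertices disjoint
from `{a,b,y,z}`, there is a `2`-path on at most `20` vertices from `ab` to `yz` avoiding
`U`. -/
theorem statement_10 (γ : ℝ) (hγ0 : 0 < γ) (hγ1 : γ < 1) :
    ∃ n₀ : ℕ, ∀ n : ℕ, n₀ ≤ n → ∀ G : Fin n → Fin n → Prop, IsDigraph G →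
      (∀ v, (8/5 + γ) * n ≤ ((outDeg G v + inDeg G v : ℕ) : ℝ)) →
      ∀ a b y z : Fin n, G a b → G y z → a ≠ y → a ≠ z → b ≠ y → b ≠ z →
        ∀ U : Set (Fin n), a ∉ U → b ∉ U → y ∉ U → z ∉ U →
          (U.ncard : ℝ) ≤ γ * n / 2 →
          ∃ Q : List (Fin n),
            IsKPath 2 G (a :: b :: (Q ++ [y, z])) ∧
            (a :: b :: (Q ++ [y, z])).length ≤ 20 ∧
            ∀ w ∈ a :: b :: (Q ++ [y, z]), w ∉ U := by
  classical
  let patterns : Finset (List (Fin 10)) := (List.finite_length_le (Fin 10) 16).toFinset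
  have hpat : ∀ σ, σ ∈ patterns ↔ σ.length ≤ 16 := by simp [patterns]
  have hC : (0 : ℝ) < #patterns := by
    exact_mod_cast Finset.card_pos.mpr ⟨[], by simp [hpat]⟩
  obtain ⟨n₀, hn₀⟩ := exists_complete_blowup 20 (by norm_num) 10 (γ ^ 10 / #patterns)
    (by positivity)
  refine ⟨n₀, fun n hn G hG hdeg a b y z hab hyz hay haz hby hbz U haU hbU hyU hzU hU => ?_⟩
  have hcount := (win_ten ⟨hγ0, hdeg, hU⟩ hab hyz).le_card hγ0.le
  let H : List (Fin 10) → (Fin 10 → Fin n) → Prop := fun σ f =>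
    (∀ i, f i ∉ U) ∧ IsSquareWalk G (a :: b :: (σ.map f ++ [y, z]))
  obtain ⟨σ, hσ, hσc⟩ : ∃ σ ∈ patterns, γ ^ 10 / #patterns * (n : ℝ) ^ 10 ≤ #{f | H σ f} := by
    refine Finset.exists_le_of_sum_le (Finset.card_pos.mp (Nat.cast_pos.mp hC)) ?_
    rw [Finset.sum_const, nsmul_eq_mul]
    calc (#patterns : ℝ) * (γ ^ 10 / #patterns * (n : ℝ) ^ 10) = (γ * n) ^ 10 := by
          field_simp
      _ ≤ _ := hcount
      _ ≤ ∑ σ ∈ patterns, (#{f | H σ f} : ℝ) := by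
          rw [← Nat.cast_sum]
          refine Nat.cast_le.mpr (le_trans (Finset.card_le_card ?_) Finset.card_biUnion_le)
          intro f hf
          obtain ⟨hfU, Q, hQ, hlen, hw⟩ := (Finset.mem_filter.mp hf).2
          obtain ⟨σ, rfl⟩ : Q ∈ Set.range (List.map f) := by
            rw [Set.range_list_map]
            simpa using hQ
          exact Finset.mem_biUnion.mpr ⟨σ, (hpat σ).mpr (by simpa using hlen),
            Finset.mem_filter.mpr ⟨Finset.mem_univ _, hfU, hw⟩⟩
  obtain ⟨X, hXc, hX⟩ := hn₀ n hn (H σ) hσc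
  have hσ16 := (hpat σ).mp hσ
  obtain ⟨Q, hQw, hQl, hnd, haQ, hbQ, hyQ, hzQ, hQX⟩ := exists_nodup_isSquareWalk hG X hXc σ
    (by omega) fun f hf => (hX f hf).2
  have hXU : ∀ i, ∀ q ∈ X i, q ∉ U := by
    intro i q hq
    have hne : ∀ j, ∃ v, v ∈ X j := fun j => Finset.card_pos.mp (by rw [hXc]; norm_num)
    choose g hg using hne
    have := (hX (Function.update g i q) (fun j => by
      by_cases hji : j = i
      · subst hji; simpa using hq
      · simpa [hji] using hg j)).1 i
    simpa using this
  have hne_ab : a ≠ b := fun h => hG b (h ▸ hab)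
  have hne_yz : y ≠ z := fun h => hG z (h ▸ hyz)
  refine ⟨Q, ⟨?_, hQw.rel_get⟩, by simp; omega, ?_⟩
  · simp only [List.nodup_cons, List.nodup_append, List.mem_cons, List.mem_append]
    grind
  · intro w hw
    simp only [List.mem_cons, List.mem_append, List.not_mem_nil, or_false] at hw
    rcases hw with rfl | rfl | hw | rfl | rfl
    · exact haU
    · exact hbU
    · obtain ⟨i, hi⟩ := hQX w hw
      exact hXU i w hi
    · exact hyU
    · exact hzU

end Paper
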